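/- arXiv:1103.1468 — 2 statements merged into one kernel-verified Lean document; each statement's English description precedes it below -/
import Mathlib

section
/- Let 0 < r₀ < 1/2 and let u₀ be a C¹ function on the circle ∂B(0, r₀) ⊂ ℝ² with mean value m(u₀) = (1/(2π r₀)) ∫_{∂B(0,r₀)} u₀. Then every u ∈ C¹(closure(B(0,1)) \ B(0,r₀), ℝ) with u = u₀ on ∂B(0,r₀) satisfies ∫_{B(0,1)\B(0,r₀)} |∇u|² ≥ (1/(4 r₀)) ∫_{∂B(0,r₀)} |u₀ − m(u₀)|². -/
open Metric MeasureTheory Real Complex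
open scoped Real

/-- The Wirtinger inequality for a mean-zero `2π`-periodic function of class `C¹`. -/
theorem integral_sq_le_integral_deriv_sq {f f' : ℝ → ℝ} (hf : ∀ x, HasDerivAt f (f' x) x)
    (hf' : Continuous f') (hper : f (-π) = f π) (hmean : ∫ x in (-π)..π, f x = 0) :
    ∫ x in (-π)..π, f x ^ 2 ≤ ∫ x in (-π)..π, f' x ^ 2 := by
  have hab : -π < π := by linarith [pi_pos]
  have memLp {g : ℝ → ℝ} (hg : Continuous g) :
      MemLp (fun x => (g x : ℂ)) 2 (volume.restrict (Set.Ioc (-π) π)) := by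
    have hc : Continuous fun x => (g x : ℂ) := by fun_prop
    obtain ⟨C, hC⟩ := isCompact_Icc.exists_bound_of_continuousOn (s := Set.Icc (-π) π)
      hc.continuousOn
    refine MemLp.of_bound hc.aestronglyMeasurable C ?_
    filter_upwards [ae_restrict_mem measurableSet_Ioc] with x hx
    exact hC x (Set.Ioc_subset_Icc_self hx)
  have hfc : Continuous f := continuous_iff_continuousAt.2 fun x => (hf x).continuousAt
  have key := hasSum_le (fun n : ℤ => ?_) (hasSum_sq_fourierCoeffOn hab (memLp hfc))
    (hasSum_sq_fourierCoeffOn hab (memLp hf'))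
  · have h2 : 0 < (π - -π)⁻¹ := inv_pos.2 (by linarith)
    simp only [norm_real, norm_eq_abs, sq_abs, smul_eq_mul] at key
    exact le_of_mul_le_mul_left key h2
  · refine pow_le_pow_left₀ (norm_nonneg _) ?_ 2
    rcases eq_or_ne n 0 with rfl | hn
    · have h0 : fourierCoeffOn hab (fun x => (f x : ℂ)) 0 = 0 := by
        simp [fourierCoeffOn_eq_integral, intervalIntegral.integral_ofReal, hmean]
      rw [h0, norm_zero]
      exact norm_nonneg _
    · rw [fourierCoeffOn_of_hasDerivAt hab (f' := fun x => (f' x : ℂ)) hn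
        (fun x _ => (hf x).ofReal_comp)
        ((continuous_ofReal.comp hf').intervalIntegrable _ _), hper, sub_self, mul_zero, zero_sub]
      have h1 : (1 : ℝ) ≤ |(n : ℝ)| := by exact_mod_cast Int.one_le_abs hn
      have h2 : ‖(π : ℂ) - ((-π : ℝ) : ℂ)‖ = 2 * π := by
        rw [← ofReal_sub, norm_real, norm_eq_abs, abs_of_pos] <;> linarith
      have hpi := pi_pos
      rw [norm_mul, norm_neg, norm_mul, h2]
      simp only [norm_div, norm_mul, norm_neg, norm_one, Complex.norm_ofNat, norm_real,
        norm_I, norm_intCast, norm_eq_abs, abs_of_pos pi_pos, mul_one]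
      rw [← mul_assoc]
      refine mul_le_of_le_one_left (norm_nonneg _) ?_
      rw [one_div_mul_eq_div, div_le_one (by positivity)]
      nlinarith

/-- The mean value minimises the mean square deviation. -/
theorem integral_sub_mean_sq_le {f : ℝ → ℝ} (hf : Continuous f) {a b m : ℝ} (hab : a ≤ b)
    (hm : (b - a) * m = ∫ x in a..b, f x) (c : ℝ) :
    ∫ x in a..b, (f x - m) ^ 2 ≤ ∫ x in a..b, (f x - c) ^ 2 := by
  have h : ∫ x in a..b, (f x - c) ^ 2 - (f x - m) ^ 2 = (b - a) * (m - c) ^ 2 := by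
    have : ∀ x, (f x - c) ^ 2 - (f x - m) ^ 2 = 2 * (m - c) * f x + (c ^ 2 - m ^ 2) :=
      fun x => by ring
    simp_rw [this]
    rw [intervalIntegral.integral_add ((by fun_prop : Continuous _).intervalIntegrable _ _)
      (by simp), intervalIntegral.integral_const_mul, ← hm]
    simp
    ring
  rw [intervalIntegral.integral_sub ((by fun_prop : Continuous _).intervalIntegrable _ _)
    ((by fun_prop : Continuous _).intervalIntegrable _ _)] at h
  nlinarith [mul_nonneg (sub_nonneg.2 hab) (sq_nonneg (m - c))]

/-- The Cauchy-Schwarz inequality against the constant function one. -/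
theorem sq_integral_le_mul_integral_sq {f : ℝ → ℝ} (hf : Continuous f) {a b : ℝ} (hab : a ≤ b) :
    (∫ x in a..b, f x) ^ 2 ≤ (b - a) * ∫ x in a..b, f x ^ 2 := by
  rcases hab.eq_or_lt with rfl | hlt
  · simp
  set J := ∫ x in a..b, f x with hJ
  have h : ∫ x in a..b, ((b - a) * f x - J) ^ 2
      = (b - a) * ((b - a) * (∫ x in a..b, f x ^ 2) - J ^ 2) := by
    have : ∀ x, ((b - a) * f x - J) ^ 2
        = (b - a) ^ 2 * f x ^ 2 - 2 * (b - a) * J * f x + J ^ 2 := fun x => by ring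
    simp_rw [this]
    rw [intervalIntegral.integral_add ((by fun_prop : Continuous _).intervalIntegrable _ _)
      (by simp), intervalIntegral.integral_sub
      ((by fun_prop : Continuous _).intervalIntegrable _ _)
      ((by fun_prop : Continuous _).intervalIntegrable _ _),
      intervalIntegral.integral_const_mul, intervalIntegral.integral_const_mul, ← hJ]
    simp
    ring
  have h0 : 0 ≤ ∫ x in a..b, ((b - a) * f x - J) ^ 2 :=
    intervalIntegral.integral_nonneg hab fun x _ => sq_nonneg _
  rw [h] at h0
  linarith [nonneg_of_mul_nonneg_right h0 (sub_pos.2 hlt)]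

/-- The energy estimate in polar coordinates: `U ρ θ` stands for the value of a function at the
point of polar coordinates `(ρ, θ)`, with radial derivative `a` and tangential derivative `b`. -/
theorem integral_sub_mean_sq_le_polar_energy {U a b : ℝ → ℝ → ℝ} {r m : ℝ} (hr : 0 < r)
    (hU : Continuous (Function.uncurry U)) (ha : Continuous (Function.uncurry a))
    (hb : Continuous (Function.uncurry b))
    (hUa : ∀ θ, ∀ ρ ∈ Set.Ioo r (2 * r), HasDerivAt (fun s => U s θ) (a ρ θ) ρ)
    (hUb : ∀ θ, ∀ ρ ∈ Set.Ioo r (2 * r), HasDerivAt (U ρ) (ρ * b ρ θ) θ)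
    (hper : ∀ ρ, U ρ (-π) = U ρ π) (hm : 2 * π * m = ∫ θ in (-π)..π, U r θ) :
    ∫ θ in (-π)..π, (U r θ - m) ^ 2
      ≤ 3 * ∫ ρ in r..2 * r, ∫ θ in (-π)..π, ρ * (a ρ θ ^ 2 + b ρ θ ^ 2) := by
  have hpi := pi_pos
  have hab : -π ≤ π := by linarith
  have hr2 : r ≤ 2 * r := by linarith
  set X := ∫ θ in (-π)..π, (U r θ - m) ^ 2
  set A := ∫ ρ in r..2 * r, ∫ θ in (-π)..π, ρ * a ρ θ ^ 2 with hA
  set B := ∫ ρ in r..2 * r, ∫ θ in (-π)..π, ρ * b ρ θ ^ 2 with hB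
  have hUρ : ∀ ρ, Continuous (U ρ) := fun ρ => by fun_prop
  have hAB : ∫ ρ in r..2 * r, ∫ θ in (-π)..π, ρ * (a ρ θ ^ 2 + b ρ θ ^ 2) = A + B := by
    rw [hA, hB, ← intervalIntegral.integral_add
      ((intervalIntegral.continuous_parametric_intervalIntegral_of_continuous'
        (by fun_prop) _ _).intervalIntegrable _ _)
      ((intervalIntegral.continuous_parametric_intervalIntegral_of_continuous'
        (by fun_prop) _ _).intervalIntegrable _ _)]
    congr 1 with ρ
    rw [← intervalIntegral.integral_add ((by fun_prop : Continuous _).intervalIntegrable _ _)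
      ((by fun_prop : Continuous _).intervalIntegrable _ _)]
    simp only [mul_add]
  have radial : ∀ ρ ∈ Set.Ioo r (2 * r), ∫ θ in (-π)..π, (U r θ - U ρ θ) ^ 2 ≤ A := by
    intro ρ hρ
    have hswap : A = ∫ θ in (-π)..π, ∫ s in r..2 * r, s * a s θ ^ 2 := by
      rw [hA]
      refine intervalIntegral_intervalIntegral_swap ?_
      have : Continuous (Function.uncurry fun s θ => s * a s θ ^ 2) := by fun_prop
      exact (this.continuousOn.integrableOn_compact
        (isCompact_uIcc.prod isCompact_uIcc)).mono_set
        (Set.prod_mono Set.uIoc_subset_uIcc Set.uIoc_subset_uIcc)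
    rw [hswap]
    refine intervalIntegral.integral_mono_on hab
      ((by fun_prop : Continuous _).intervalIntegrable _ _)
      ((intervalIntegral.continuous_parametric_intervalIntegral_of_continuous'
        (by fun_prop) _ _).intervalIntegrable _ _) fun θ _ => ?_
    have ftc : ∫ s in r..ρ, a s θ = U ρ θ - U r θ :=
      intervalIntegral.integral_eq_sub_of_hasDerivAt_of_le hρ.1.le
        (by fun_prop : Continuous fun s => U s θ).continuousOn
        (fun s hs => hUa θ s ⟨hs.1, hs.2.trans hρ.2⟩)
        ((by fun_prop : Continuous fun s => a s θ).intervalIntegrable _ _)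
    calc (U r θ - U ρ θ) ^ 2 = (∫ s in r..ρ, a s θ) ^ 2 := by rw [ftc]; ring
      _ ≤ (ρ - r) * ∫ s in r..ρ, a s θ ^ 2 :=
        sq_integral_le_mul_integral_sq (by fun_prop) hρ.1.le
      _ = ∫ s in r..ρ, (ρ - r) * a s θ ^ 2 := by rw [intervalIntegral.integral_const_mul]
      _ ≤ ∫ s in r..ρ, s * a s θ ^ 2 := by
        refine intervalIntegral.integral_mono_on hρ.1.le
          ((by fun_prop : Continuous _).intervalIntegrable _ _)
          ((by fun_prop : Continuous _).intervalIntegrable _ _) fun s hs => ?_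
        exact mul_le_mul_of_nonneg_right (by linarith [hs.1, hρ.2]) (sq_nonneg _)
      _ ≤ ∫ s in r..2 * r, s * a s θ ^ 2 := by
        refine intervalIntegral.integral_mono_interval le_rfl hρ.1.le hρ.2.le ?_
          ((by fun_prop : Continuous _).intervalIntegrable _ _)
        filter_upwards [ae_restrict_mem measurableSet_Ioc] with s hs
        exact mul_nonneg (hr.trans hs.1).le (sq_nonneg _)
  have tangential : ∀ ρ ∈ Set.Ioo r (2 * r),
      X ≤ 3 * A + 3 / 2 * ∫ θ in (-π)..π, (ρ * b ρ θ) ^ 2 := by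
    intro ρ hρ
    set c := (2 * π)⁻¹ * ∫ θ in (-π)..π, U ρ θ with hc
    have hw := integral_sq_le_integral_deriv_sq (f := fun θ => U ρ θ - c)
      (fun θ => (hUb θ ρ hρ).sub_const c) (by fun_prop) (by simp [hper]) (by
        rw [intervalIntegral.integral_sub ((hUρ ρ).intervalIntegrable _ _) (by simp), hc]
        simp
        field_simp
        ring)
    calc X ≤ ∫ θ in (-π)..π, (U r θ - c) ^ 2 :=
        integral_sub_mean_sq_le (hUρ r) hab (by rw [← hm]; ring) c
      _ ≤ ∫ θ in (-π)..π, (3 * (U r θ - U ρ θ) ^ 2 + 3 / 2 * (U ρ θ - c) ^ 2) := by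
        refine intervalIntegral.integral_mono_on hab
          ((by fun_prop : Continuous _).intervalIntegrable _ _)
          ((by fun_prop : Continuous _).intervalIntegrable _ _) fun θ _ => ?_
        nlinarith [sq_nonneg (2 * (U r θ - U ρ θ) - (U ρ θ - c))]
      _ = 3 * (∫ θ in (-π)..π, (U r θ - U ρ θ) ^ 2)
          + 3 / 2 * ∫ θ in (-π)..π, (U ρ θ - c) ^ 2 := by
        rw [intervalIntegral.integral_add ((by fun_prop : Continuous _).intervalIntegrable _ _)
          ((by fun_prop : Continuous _).intervalIntegrable _ _),
          intervalIntegral.integral_const_mul, intervalIntegral.integral_const_mul]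
      _ ≤ _ := by linarith [radial ρ hρ]
  have hint : ∫ _ρ in r..2 * r, X
      ≤ ∫ ρ in r..2 * r, (3 * A + 3 * r * ∫ θ in (-π)..π, ρ * b ρ θ ^ 2) := by
    have hcB : Continuous fun ρ => ∫ θ in (-π)..π, ρ * b ρ θ ^ 2 :=
      intervalIntegral.continuous_parametric_intervalIntegral_of_continuous' (by fun_prop) _ _
    refine intervalIntegral.integral_mono_on_of_le_Ioo hr2 (by simp)
      ((by fun_prop : Continuous _).intervalIntegrable _ _) fun ρ hρ => ?_
    refine (tangential ρ hρ).trans (add_le_add le_rfl ?_)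
    rw [← intervalIntegral.integral_const_mul, ← intervalIntegral.integral_const_mul]
    refine intervalIntegral.integral_mono_on hab
      ((by fun_prop : Continuous _).intervalIntegrable _ _)
      ((by fun_prop : Continuous _).intervalIntegrable _ _) fun θ _ => ?_
    have : 0 ≤ (2 * r - ρ) * (ρ * b ρ θ ^ 2) :=
      mul_nonneg (by linarith [hρ.2]) (mul_nonneg (hr.trans hρ.1).le (sq_nonneg _))
    nlinarith
  rw [intervalIntegral.integral_add (by simp)
    ((intervalIntegral.continuous_parametric_intervalIntegral_of_continuous'
      (by fun_prop) _ _).intervalIntegrable _ _ |>.const_mul _),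
    intervalIntegral.integral_const_mul (3 * r), ← hB,
    intervalIntegral.integral_const, intervalIntegral.integral_const, smul_eq_mul, smul_eq_mul]
    at hint
  rw [hAB]
  exact le_of_mul_le_mul_left (by linarith) hr

/-- Integration over an annulus in polar coordinates. -/
theorem setIntegral_annulus_eq_polar (g : ℂ → ℝ) {s t : ℝ} (hs : 0 ≤ s) :
    ∫ z in ball (0 : ℂ) t \ closedBall 0 s, g z
      = ∫ p in Set.Ioo s t ×ˢ Set.Ioo (-π) π, p.1 * g (p.1 * Complex.exp (p.2 * Complex.I)) := by
  rw [← integral_indicator (measurableSet_ball.diff measurableSet_closedBall),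
    ← Complex.integral_comp_polarCoord_symm]
  have hsub : Set.Ioo s t ×ˢ Set.Ioo (-π) π
      = polarCoord.target ∩ Set.Ioo s t ×ˢ Set.univ := by
    ext p
    simp only [polarCoord_target, Set.mem_prod, Set.mem_inter_iff, Set.mem_Ioo, Set.mem_Ioi,
      Set.mem_univ, and_true]
    exact ⟨fun h => ⟨⟨hs.trans_lt h.1.1, h.2⟩, h.1⟩, fun h => ⟨h.2, h.1.2⟩⟩
  rw [hsub, ← setIntegral_indicator (measurableSet_Ioo.prod MeasurableSet.univ)]
  refine setIntegral_congr_fun polarCoord.open_target.measurableSet fun p hp => ?_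
  have hp0 : 0 < p.1 := hp.1
  have hnorm : ‖Complex.polarCoord.symm p‖ = p.1 := by
    rw [Complex.norm_polarCoord_symm, abs_of_pos hp0]
  have hsymm : Complex.polarCoord.symm p = p.1 * Complex.exp (p.2 * Complex.I) := by
    rw [Complex.polarCoord_symm_apply, Complex.exp_mul_I]
    push_cast
    rfl
  have hiff : Complex.polarCoord.symm p ∈ ball (0 : ℂ) t \ closedBall 0 s
      ↔ p ∈ Set.Ioo s t ×ˢ (Set.univ : Set ℝ) := by
    simp only [Set.mem_sdiff, mem_ball_zero_iff, mem_closedBall_zero_iff, hnorm, not_le,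
      Set.mem_prod, Set.mem_Ioo, Set.mem_univ, and_true]
    exact and_comm
  by_cases h : p ∈ Set.Ioo s t ×ˢ (Set.univ : Set ℝ)
  · rw [Set.indicator_of_mem h, Set.indicator_of_mem (hiff.2 h), smul_eq_mul, hsymm]
  · rw [Set.indicator_of_notMem h, Set.indicator_of_notMem (mt hiff.1 h), smul_zero]

/-- A closed planar annulus has unique derivatives up to the boundary: near each of its points it
contains a convex circular segment. -/
theorem uniqueDiffOn_closedBall_diff_ball {s t : ℝ} (hs : 0 < s) (hst : s < t) :
    UniqueDiffOn ℝ (closedBall (0 : ℂ) t \ ball 0 s) := by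
  intro x hx
  have hxs : s ≤ ‖x‖ := by simpa using hx.2
  have hx0 : 0 < ‖x‖ := hs.trans_le hxs
  let ℓ : ℂ →L[ℝ] ℝ := innerSL ℝ x
  set H := closedBall (0 : ℂ) t ∩ {z | s * ‖x‖ ≤ ℓ z}
  have hHs : H ⊆ closedBall (0 : ℂ) t \ ball 0 s := by
    rintro z ⟨hz, hz'⟩
    refine ⟨hz, fun hzs => ?_⟩
    have h1 : ℓ z ≤ ‖x‖ * ‖z‖ := real_inner_le_norm x z
    have h2 : ‖z‖ < s := by simpa using hzs
    have h3 : s * ‖x‖ ≤ ℓ z := hz'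
    nlinarith
  refine UniqueDiffWithinAt.mono (s := H) ?_ hHs
  refine uniqueDiffOn_convex ?_ ?_ x ⟨hx.1, ?_⟩
  · exact (convex_closedBall _ _).inter (convex_halfSpace_ge ℓ.toLinearMap.isLinear _)
  · have hopen : IsOpen (ball (0 : ℂ) t ∩ {z | s * ‖x‖ < ℓ z}) :=
      isOpen_ball.inter (isOpen_lt continuous_const ℓ.continuous)
    have hsub : ball (0 : ℂ) t ∩ {z | s * ‖x‖ < ℓ z} ⊆ H :=
      Set.inter_subset_inter ball_subset_closedBall fun z hz => by
        rw [Set.mem_ofPred_eq] at hz ⊢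
        exact hz.le
    refine Set.Nonempty.mono (interior_maximal hsub hopen) ⟨((s + t) / 2 / ‖x‖) • x, ?_, ?_⟩
    · rw [mem_ball_zero_iff, norm_smul, Real.norm_of_nonneg (div_nonneg (by linarith) hx0.le),
        div_mul_cancel₀ _ hx0.ne']
      linarith
    · have : ℓ (((s + t) / 2 / ‖x‖) • x) = (s + t) / 2 * ‖x‖ := by
        rw [map_smul, smul_eq_mul, innerSL_apply_apply, real_inner_self_eq_norm_sq]
        field_simp
      simp only [Set.mem_ofPred_eq, this]
      nlinarith
  · have : ℓ x = ‖x‖ ^ 2 := real_inner_self_eq_norm_sq x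
    simp only [Set.mem_ofPred_eq, this]
    nlinarith

/-- The squared components of a real linear form on `ℂ` along a unit vector and its rotation by a
right angle add up to at most its squared norm. -/
theorem sq_apply_add_sq_apply_I_mul_le (L : ℂ →L[ℝ] ℝ) {e : ℂ} (he : ‖e‖ = 1) :
    L e ^ 2 + L (Complex.I * e) ^ 2 ≤ ‖L‖ ^ 2 := by
  set a := L e with ha
  set b := L (Complex.I * e) with hb
  have h1 : L (a • e + b • (Complex.I * e)) = a ^ 2 + b ^ 2 := by
    rw [map_add, map_smul, map_smul, ← ha, ← hb]
    simp only [smul_eq_mul]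
    ring
  have h2 : ‖a • e + b • (Complex.I * e)‖ ^ 2 = a ^ 2 + b ^ 2 := by
    have : a • e + b • (Complex.I * e) = (a + b * Complex.I) * e := by
      simp only [real_smul]
      ring
    rw [this, norm_mul, he, mul_one, ← normSq_eq_norm_sq, normSq_add_mul_I]
  have h3 : a ^ 2 + b ^ 2 ≤ ‖L‖ * ‖a • e + b • (Complex.I * e)‖ := by
    rw [← h1]
    exact (le_abs_self _).trans (L.le_opNorm _)
  rcases (by positivity : 0 ≤ a ^ 2 + b ^ 2).eq_or_lt with h | h
  · rw [← h]
    positivity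
  · have h4 := pow_le_pow_left₀ h.le h3 2
    rw [mul_pow, h2, sq (a ^ 2 + b ^ 2)] at h4
    exact le_of_mul_le_mul_right h4 h

/-- Dirichlet-energy lower bound on the annulus `B(0,1) \ B(0,r₀)` in the plane (`ℝ² ≃ ℂ`):
for `0 < r₀ < 1/2` and `u` of class `C¹` on the closed annulus with boundary value `u₀`
on the inner circle of mean `m`,
`∫ |∇u|² ≥ (1/(4r₀)) ∫_{∂B(0,r₀)} |u₀ − m|²` (the boundary integral w.r.t. arc length). -/
theorem dirichlet_energy_lower_bound_annulus
    (r₀ : ℝ) (h0 : 0 < r₀) (hr : r₀ < 1 / 2)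
    (u : ℂ → ℝ)
    (hu : ContDiffOn ℝ 1 u (closedBall 0 1 \ ball 0 r₀))
    (m : ℝ)
    (hm : m = (1 / (2 * π)) *
      ∫ θ in (0 : ℝ)..(2 * π), u ((r₀ : ℂ) * Complex.exp (θ * Complex.I))) :
    (1 / (4 * r₀)) * (r₀ *
        ∫ θ in (0 : ℝ)..(2 * π),
          (u ((r₀ : ℂ) * Complex.exp (θ * Complex.I)) - m) ^ 2)
      ≤ ∫ x in ball (0 : ℂ) 1 \ ball 0 r₀, ‖fderiv ℝ u x‖ ^ 2 := by
  have hpi := pi_pos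
  set S := closedBall (0 : ℂ) 1 \ ball 0 r₀ with hS
  have hScomp : IsCompact S := (isCompact_closedBall _ _).diff isOpen_ball
  set F := fderivWithin ℝ u S
  have hFc : ContinuousOn F S := hu.continuousOn_fderivWithin
    (uniqueDiffOn_closedBall_diff_ball h0 (by linarith)) le_rfl
  have hSnhds : ∀ z : ℂ, r₀ < ‖z‖ → ‖z‖ < 1 → S ∈ nhds z := fun z h1 h2 => by
    refine Filter.mem_of_superset
      ((isOpen_ball.sdiff isClosed_closedBall).mem_nhds (x := z) (s := ball 0 1 \ closedBall 0 r₀)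
        ⟨by simpa using h2, by simpa using h1⟩)
      (Set.sdiff_subset_sdiff ball_subset_closedBall ball_subset_closedBall)
  have hFeq : ∀ z : ℂ, r₀ < ‖z‖ → ‖z‖ < 1 → fderiv ℝ u z = F z := fun z h1 h2 =>
    (fderivWithin_of_mem_nhds (hSnhds z h1 h2)).symm
  have hderiv : ∀ z : ℂ, r₀ < ‖z‖ → ‖z‖ < 1 → HasFDerivAt u (F z) z := fun z h1 h2 => by
    rw [← hFeq z h1 h2]
    exact ((hu.contDiffAt (hSnhds z h1 h2)).differentiableAt one_ne_zero).hasFDerivAt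
  set c : ℝ → ℝ := fun ρ => max r₀ (min ρ (2 * r₀)) with hc
  have hcc : Continuous c := by fun_prop
  have hc1 : ∀ ρ, r₀ ≤ c ρ := fun ρ => le_max_left _ _
  have hc2 : ∀ ρ, c ρ ≤ 2 * r₀ := fun ρ => max_le (by linarith) (min_le_right _ _)
  have hc3 : ∀ ρ ∈ Set.Icc r₀ (2 * r₀), c ρ = ρ := fun ρ hρ => by
    rw [hc]
    simp only [min_eq_left hρ.2, max_eq_right hρ.1]
  set P : ℝ → ℝ → ℂ := fun ρ θ => c ρ * Complex.exp (θ * Complex.I) with hP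
  have hPc : Continuous (Function.uncurry P) := by
    simp only [hP, Function.uncurry_def]
    fun_prop
  have hPnorm : ∀ ρ θ, ‖P ρ θ‖ = c ρ := fun ρ θ => by
    rw [hP, norm_mul, Complex.norm_exp_ofReal_mul_I, mul_one, norm_real,
      Real.norm_of_nonneg (h0.le.trans (hc1 ρ))]
  have hPS : ∀ p : ℝ × ℝ, Function.uncurry P p ∈ S := fun p => by
    have h1 := hc1 p.1
    have h2 := hc2 p.1
    simp only [Function.uncurry_def, hS, Set.mem_sdiff, mem_closedBall_zero_iff, mem_ball_zero_iff,
      hPnorm, not_lt]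
    constructor <;> linarith
  have hPin : ∀ θ, ∀ ρ ∈ Set.Ioo r₀ (2 * r₀), r₀ < ‖P ρ θ‖ ∧ ‖P ρ θ‖ < 1 := fun θ ρ hρ => by
    rw [hPnorm, hc3 ρ (Set.Ioo_subset_Icc_self hρ)]
    exact ⟨hρ.1, by linarith [hρ.2]⟩
  have hFP : Continuous fun p : ℝ × ℝ => F (P p.1 p.2) := hFc.comp_continuous hPc hPS
  have hshift : ∀ φ : ℝ → ℝ,
      ∫ θ in (0 : ℝ)..(2 * π), φ (u ((r₀ : ℂ) * Complex.exp (θ * Complex.I)))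
        = ∫ θ in (-π)..π, φ (u (P r₀ θ)) := fun φ => by
    have hper : Function.Periodic
        (fun θ : ℝ => φ (u ((r₀ : ℂ) * Complex.exp (θ * Complex.I)))) (2 * π) := fun θ => by
      simp only [ofReal_add, ofReal_mul, ofReal_ofNat, add_mul, Complex.exp_add,
        Complex.exp_two_pi_mul_I, mul_one]
    have h := hper.intervalIntegral_add_eq 0 (-π)
    rw [zero_add, show -π + 2 * π = π by ring] at h
    simp only [h, hP, hc3 r₀ ⟨le_rfl, by linarith⟩]
  have hpolar := integral_sub_mean_sq_le_polar_energy (U := fun ρ θ => u (P ρ θ))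
    (a := fun ρ θ => F (P ρ θ) (Complex.exp (θ * Complex.I)))
    (b := fun ρ θ => F (P ρ θ) (Complex.I * Complex.exp (θ * Complex.I))) (m := m) h0
    (hu.continuousOn.comp_continuous hPc hPS)
    (hFP.clm_apply (by fun_prop)) (hFP.clm_apply (by fun_prop))
    (fun θ ρ hρ => by
      refine (hderiv _ (hPin θ ρ hρ).1 (hPin θ ρ hρ).2).comp_hasDerivAt ρ ?_
      have h1 : HasDerivAt (fun s : ℝ => (s : ℂ) * Complex.exp (θ * Complex.I))
          (Complex.exp (θ * Complex.I)) ρ := by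
        simpa using (hasDerivAt_id ρ).ofReal_comp.mul_const (Complex.exp (θ * Complex.I))
      refine h1.congr_of_eventuallyEq ?_
      filter_upwards [isOpen_Ioo.mem_nhds hρ] with s hs
      simp only [hP, hc3 s (Set.Ioo_subset_Icc_self hs)])
    (fun θ ρ hρ => by
      have h1 : HasDerivAt (P ρ) (ρ • (Complex.I * Complex.exp (θ * Complex.I))) θ := by
        have h2 := (((hasDerivAt_id θ).ofReal_comp.mul_const Complex.I).cexp).const_mul (c ρ : ℂ)
        refine h2.congr_deriv ?_
        rw [hc3 ρ (Set.Ioo_subset_Icc_self hρ), real_smul]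
        simp only [id, ofReal_one]
        ring
      have h3 := (hderiv _ (hPin θ ρ hρ).1 (hPin θ ρ hρ).2).comp_hasDerivAt θ h1
      rw [map_smul, smul_eq_mul] at h3
      exact h3)
    (fun ρ => by simp [hP, Complex.exp_neg]) ?mean
  case mean =>
    rw [← hshift (fun x => x), hm, ← mul_assoc, mul_one_div_cancel (by positivity), one_mul]
  have hLHS := hshift fun x => (x - m) ^ 2
  have hcont : Continuous fun p : ℝ × ℝ => p.1 * (F (P p.1 p.2) (Complex.exp (p.2 * Complex.I)) ^ 2
      + F (P p.1 p.2) (Complex.I * Complex.exp (p.2 * Complex.I)) ^ 2) :=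
    continuous_fst.mul (((hFP.clm_apply (by fun_prop)).pow 2).add
      ((hFP.clm_apply (by fun_prop)).pow 2))
  have hcont' : Continuous fun p : ℝ × ℝ => p.1 * ‖F (P p.1 p.2)‖ ^ 2 :=
    continuous_fst.mul (hFP.norm.pow 2)
  have hR : ∀ {g : ℝ × ℝ → ℝ}, Continuous g →
      IntegrableOn g (Set.Ioo r₀ (2 * r₀) ×ˢ Set.Ioo (-π) π) := fun {g} hg =>
    (hg.continuousOn.integrableOn_compact (isCompact_Icc.prod isCompact_Icc)).mono_set
      (Set.prod_mono Set.Ioo_subset_Icc_self Set.Ioo_subset_Icc_self)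
  have hRm : MeasurableSet (Set.Ioo r₀ (2 * r₀) ×ˢ Set.Ioo (-π) π) :=
    measurableSet_Ioo.prod measurableSet_Ioo
  have hiter : ∫ ρ in r₀..2 * r₀, ∫ θ in (-π)..π,
        ρ * (F (P ρ θ) (Complex.exp (θ * Complex.I)) ^ 2
          + F (P ρ θ) (Complex.I * Complex.exp (θ * Complex.I)) ^ 2)
      = ∫ p in Set.Ioo r₀ (2 * r₀) ×ˢ Set.Ioo (-π) π,
        p.1 * (F (P p.1 p.2) (Complex.exp (p.2 * Complex.I)) ^ 2
          + F (P p.1 p.2) (Complex.I * Complex.exp (p.2 * Complex.I)) ^ 2) := by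
    rw [Measure.volume_eq_prod, setIntegral_prod _ (hR hcont),
      intervalIntegral.integral_of_le (by linarith), integral_Ioc_eq_integral_Ioo]
    simp_rw [intervalIntegral.integral_of_le (by linarith : -π ≤ π), integral_Ioc_eq_integral_Ioo]
  have hle : ∫ p in Set.Ioo r₀ (2 * r₀) ×ˢ Set.Ioo (-π) π,
        p.1 * (F (P p.1 p.2) (Complex.exp (p.2 * Complex.I)) ^ 2
          + F (P p.1 p.2) (Complex.I * Complex.exp (p.2 * Complex.I)) ^ 2)
      ≤ ∫ p in Set.Ioo r₀ (2 * r₀) ×ˢ Set.Ioo (-π) π, p.1 * ‖F (P p.1 p.2)‖ ^ 2 :=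
    setIntegral_mono_on (hR hcont) (hR hcont') hRm fun p hp =>
      mul_le_mul_of_nonneg_left
        (sq_apply_add_sq_apply_I_mul_le _ (Complex.norm_exp_ofReal_mul_I _)) (h0.trans hp.1.1).le
  have hann : ∫ z in ball (0 : ℂ) (2 * r₀) \ closedBall 0 r₀, ‖fderiv ℝ u z‖ ^ 2
      = ∫ p in Set.Ioo r₀ (2 * r₀) ×ˢ Set.Ioo (-π) π, p.1 * ‖F (P p.1 p.2)‖ ^ 2 := by
    rw [setIntegral_annulus_eq_polar _ h0.le]
    refine setIntegral_congr_fun hRm fun p hp => ?_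
    have hPp : P p.1 p.2 = p.1 * Complex.exp (p.2 * Complex.I) := by
      simp only [hP, hc3 p.1 (Set.Ioo_subset_Icc_self hp.1)]
    have hin := hPin p.2 p.1 hp.1
    simp only [← hPp, hFeq _ hin.1 hin.2]
  have hint : IntegrableOn (fun z => ‖fderiv ℝ u z‖ ^ 2) (ball (0 : ℂ) 1 \ ball 0 r₀) := by
    have h1 : IntegrableOn (fun z => ‖F z‖ ^ 2) (ball (0 : ℂ) 1 \ ball 0 r₀) :=
      ((hFc.norm.pow 2).integrableOn_compact hScomp).mono_set
        (Set.sdiff_subset_sdiff_left ball_subset_closedBall)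
    refine h1.congr_fun_ae ?_
    have hsph : ∀ᵐ z : ℂ, z ∉ sphere (0 : ℂ) r₀ :=
      measure_eq_zero_iff_ae_notMem.1 (Measure.addHaar_sphere volume 0 r₀)
    filter_upwards [ae_restrict_mem (measurableSet_ball.diff measurableSet_ball),
      ae_restrict_of_ae hsph] with z hz hzs
    have h2 : r₀ ≤ ‖z‖ := by simpa using hz.2
    have h3 : ‖z‖ ≠ r₀ := by simpa using hzs
    rw [hFeq z (lt_of_le_of_ne h2 h3.symm) (by simpa using hz.1)]
  have hmono : ∫ z in ball (0 : ℂ) (2 * r₀) \ closedBall 0 r₀, ‖fderiv ℝ u z‖ ^ 2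
      ≤ ∫ z in ball (0 : ℂ) 1 \ ball 0 r₀, ‖fderiv ℝ u z‖ ^ 2 :=
    setIntegral_mono_set hint (Filter.Eventually.of_forall fun z => sq_nonneg _)
      (Set.sdiff_subset_sdiff (ball_subset_ball (by linarith)) ball_subset_closedBall).eventuallyLE
  have hE : 0 ≤ ∫ z in ball (0 : ℂ) 1 \ ball 0 r₀, ‖fderiv ℝ u z‖ ^ 2 :=
    integral_nonneg fun z => sq_nonneg _
  rw [hiter, ← hLHS] at hpolar
  rw [hann] at hmono
  rw [← mul_assoc, show 1 / (4 * r₀) * r₀ = 1 / 4 by field_simp]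
  linarith
end

section
/- Let 0 < r₀ < 1/2, q ∈ ℝ² with r₀ < (1/2)·dist(q, ∂B(0,1)), and u₀ ∈ C¹(∂B(q, r₀), ℝ) with mean m(u₀) = (1/(2π r₀)) ∫_{∂B(q,r₀)} u₀. Then every u ∈ C¹(closure(B(0,1)) \ B(q, r₀), ℝ) with u = u₀ on ∂B(q, r₀) satisfies ∫_{B(0,1)\B(q,r₀)} |∇u|² ≥ (1/(4 r₀)) ∫_{∂B(q,r₀)} |u₀ − m(u₀)|². -/
open Metric MeasureTheory Real Complex
open scoped Real

/-- **Wirtinger inequality**: the variance of a periodic function is at most the energy of its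
derivative. -/
theorem integral_sq_sub_sq_integral_le_integral_deriv_sq {f f' : ℝ → ℝ}
    (hf : ∀ x, HasDerivAt f (f' x) x) (hf' : Continuous f') (hper : f (2 * π) = f 0) :
    (∫ x in (0 : ℝ)..(2 * π), f x ^ 2) - (∫ x in (0 : ℝ)..(2 * π), f x) ^ 2 / (2 * π)
      ≤ ∫ x in (0 : ℝ)..(2 * π), f' x ^ 2 := by
  have hab : (0 : ℝ) < 2 * π := by positivity
  have hfc : Continuous f := continuous_iff_continuousAt.2 fun x => (hf x).continuousAt
  have memLp (g : ℝ → ℝ) (hg : Continuous g) :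
      MemLp (fun x => (g x : ℂ)) 2 (volume.restrict (Set.Ioc 0 (2 * π))) := by
    have h : Continuous fun x => (g x : ℂ) := by fun_prop
    exact (memLp_two_iff_integrable_sq_norm h.aestronglyMeasurable).2
      ((h.norm.pow 2).intervalIntegrable _ _).1
  have parseval (g : ℝ → ℝ) (hg : Continuous g) := hasSum_sq_fourierCoeffOn hab (memLp g hg)
  have hs := parseval f hfc
  have hs' := parseval f' hf'
  simp only [Complex.norm_real, Real.norm_eq_abs, sq_abs, sub_zero, smul_eq_mul] at hs hs'
  have hc0 : ‖fourierCoeffOn hab (fun x => (f x : ℂ)) 0‖ ^ 2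
      = ((2 * π)⁻¹ * ∫ x in (0 : ℝ)..(2 * π), f x) ^ 2 := by
    rw [fourierCoeffOn_eq_integral]
    simp only [neg_zero, fourier_zero, one_smul, sub_zero, intervalIntegral.integral_ofReal]
    rw [norm_smul, Complex.norm_real, mul_pow, Real.norm_eq_abs, Real.norm_eq_abs, sq_abs, sq_abs]
    ring
  have hcn (n : ℤ) (hn : n ≠ 0) : ‖fourierCoeffOn hab (fun x => (f x : ℂ)) n‖ ^ 2
      ≤ ‖fourierCoeffOn hab (fun x => (f' x : ℂ)) n‖ ^ 2 := by
    have hint : IntervalIntegrable (fun x => (f' x : ℂ)) volume 0 (2 * π) :=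
      (by fun_prop : Continuous fun x => (f' x : ℂ)).intervalIntegrable _ _
    rw [fourierCoeffOn_of_hasDerivAt hab hn (fun x _ => (hf x).ofReal_comp) hint]
    simp only [hper, sub_self, mul_zero, zero_sub]
    have hn1 : (1 : ℝ) ≤ |(n : ℝ)| := by exact_mod_cast Int.one_le_abs hn
    gcongr
    simp only [norm_div, norm_neg, norm_one, Complex.norm_ofNat, Complex.norm_real, Complex.norm_I,
      Complex.norm_intCast, Complex.ofReal_mul, Complex.ofReal_ofNat, Complex.ofReal_zero, sub_zero,
      norm_mul, mul_one, Real.norm_eq_abs,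
      abs_of_pos Real.pi_pos]
    rw [div_mul_eq_mul_div, one_mul, div_le_iff₀ (by positivity)]
    have := norm_nonneg (fourierCoeffOn hab (fun x => (f' x : ℂ)) n)
    have h2 : 0 ≤ 2 * π * ‖fourierCoeffOn hab (fun x => (f' x : ℂ)) n‖ := by positivity
    nlinarith
  have key := hasSum_le (fun n => ?_) (hs.update 0 0) hs'
  · rw [hc0] at key
    field_simp at key ⊢
    linarith
  · by_cases h : n = 0
    · simp [h]
    · simpa [h] using hcn n h

/-- A function of class `C¹` on a compact set has bounded derivative on its interior. -/
theorem ContDiffOn.exists_norm_fderiv_le {E F : Type*} [NormedAddCommGroup E] [NormedSpace ℝ E]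
    [NormedAddCommGroup F] [NormedSpace ℝ F] {f : E → F} {s : Set E}
    (hf : ContDiffOn ℝ 1 f s) (hs : IsCompact s) :
    ∃ C, ∀ y ∈ interior s, ‖fderiv ℝ f y‖ ≤ C := by
  suffices h : ∃ C, ∀ y ∈ s, y ∈ interior s → ‖fderiv ℝ f y‖ ≤ C by
    obtain ⟨C, hC⟩ := h
    exact ⟨C, fun y hy => hC y (interior_subset hy) hy⟩
  refine hs.induction_on (p := fun t => ∃ C, ∀ y ∈ t, y ∈ interior s → ‖fderiv ℝ f y‖ ≤ C)
    ⟨0, by simp⟩ (fun t t' h ⟨C, hC⟩ => ⟨C, fun y hy => hC y (h hy)⟩) ?_ ?_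
  · rintro t t' ⟨C, hC⟩ ⟨C', hC'⟩
    refine ⟨max C C', fun y hy hys => ?_⟩
    rcases hy with hy | hy
    · exact (hC y hy hys).trans (le_max_left _ _)
    · exact (hC' y hy hys).trans (le_max_right _ _)
  · intro x hx
    have h1 : ContDiffWithinAt ℝ (0 + 1) f s x := by simpa using hf x hx
    obtain ⟨v, hv, -, f', hf', hcont⟩ :=
      (contDiffWithinAt_succ_iff_hasFDerivWithinAt (by simp)).1 h1
    rw [Set.insert_eq_of_mem hx] at hv
    have hxv : x ∈ v := mem_of_mem_nhdsWithin hx hv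
    have hb : ∀ᶠ y in nhdsWithin x v, ‖f' y‖ < ‖f' x‖ + 1 :=
      hcont.continuousWithinAt.norm.eventually_lt continuousWithinAt_const (lt_add_one _)
    obtain ⟨U, hUo, hxU, hU⟩ := mem_nhdsWithin.1 hv
    obtain ⟨U', hUo', hxU', hU'⟩ := mem_nhdsWithin.1 hb
    refine ⟨U ∩ U', mem_nhdsWithin_of_mem_nhds ((hUo.inter hUo').mem_nhds ⟨hxU, hxU'⟩),
      ‖f' x‖ + 1, fun y hy hys => ?_⟩
    have hyv : v ∈ nhds y := Filter.mem_of_superset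
      ((hUo.inter isOpen_interior).mem_nhds ⟨hy.1, hys⟩)
      ((Set.inter_subset_inter_right _ interior_subset).trans hU)
    have hy_v := mem_of_mem_nhds hyv
    rw [((hf' y hy_v).hasFDerivAt hyv).fderiv]
    exact (hU' ⟨hy.2, hy_v⟩).le

theorem hasDerivAt_intervalIntegral_of_bounded {G G' : ℝ → ℝ → ℝ} {s : Set ℝ} {r C a b : ℝ}
    (hs : s ∈ nhds r) (hG : ∀ x ∈ s, Continuous (G x)) (hG' : Continuous (G' r))
    (hbound : ∀ x ∈ s, ∀ t, |G' x t| ≤ C)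
    (hderiv : ∀ x ∈ s, ∀ t, HasDerivAt (fun y => G y t) (G' x t) x) :
    HasDerivAt (fun x => ∫ t in a..b, G x t) (∫ t in a..b, G' r t) r :=
  (intervalIntegral.hasDerivAt_integral_of_dominated_loc_of_deriv_le (bound := fun _ => C) hs
    (Filter.mem_of_superset hs fun x hx => (hG x hx).aestronglyMeasurable)
    ((hG r (mem_of_mem_nhds hs)).intervalIntegrable _ _) hG'.aestronglyMeasurable
    (Filter.Eventually.of_forall fun t _ x hx => hbound x hx t)
    intervalIntegrable_const
    (Filter.Eventually.of_forall fun t _ x hx => hderiv x hx t)).2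

theorem continuousOn_intervalIntegral_of_bounded {G : ℝ → ℝ → ℝ} {s : Set ℝ} {C a b : ℝ}
    (hG : ∀ x ∈ s, Continuous (G x)) (hbound : ∀ x ∈ s, ∀ t, |G x t| ≤ C)
    (hcont : ∀ t, ContinuousOn (fun x => G x t) s) :
    ContinuousOn (fun x => ∫ t in a..b, G x t) s := fun x hx =>
  intervalIntegral.continuousWithinAt_of_dominated_interval (bound := fun _ => C)
    (Filter.mem_of_superset self_mem_nhdsWithin fun y hy => (hG y hy).aestronglyMeasurable)
    (eventually_mem_nhdsWithin.mono fun y hy =>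
      Filter.Eventually.of_forall fun t _ => hbound y hy t)
    intervalIntegrable_const
    (Filter.Eventually.of_forall fun t _ => hcont t x hx)

theorem integral_sq_add_mul_add_nonneg {f h : ℝ → ℝ} (hf : Continuous f) (hh : Continuous h)
    (s : ℝ) :
    0 ≤ s ^ 2 * ((∫ x in (0 : ℝ)..(2 * π), f x ^ 2) - (∫ x in (0 : ℝ)..(2 * π), f x) ^ 2 / (2 * π))
      + s * ((∫ x in (0 : ℝ)..(2 * π), 2 * f x * h x)
        - (2 * (∫ x in (0 : ℝ)..(2 * π), f x) * ∫ x in (0 : ℝ)..(2 * π), h x) / (2 * π))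
      + ∫ x in (0 : ℝ)..(2 * π), h x ^ 2 := by
  set m := (∫ x in (0 : ℝ)..(2 * π), f x) / (2 * π) with hm
  have hI : (∫ x in (0 : ℝ)..(2 * π), f x) = 2 * π * m := by rw [hm]; field_simp
  have key : ∫ x in (0 : ℝ)..(2 * π), (s * (f x - m) + h x) ^ 2
      = ∫ x in (0 : ℝ)..(2 * π), (s ^ 2 * f x ^ 2 + (-2 * s ^ 2 * m) * f x + s ^ 2 * m ^ 2
        + s * (2 * f x * h x) + (-2 * s * m) * h x + h x ^ 2) := by
    congr 1; ext x; ring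
  have hnn : 0 ≤ ∫ x in (0 : ℝ)..(2 * π), (s * (f x - m) + h x) ^ 2 :=
    intervalIntegral.integral_nonneg (by positivity) fun x _ => sq_nonneg _
  have ii {k : ℝ → ℝ} (hk : Continuous k) : IntervalIntegrable k volume 0 (2 * π) :=
    hk.intervalIntegrable _ _
  rw [key, intervalIntegral.integral_add (ii (by fun_prop)) (ii (by fun_prop)),
    intervalIntegral.integral_add (ii (by fun_prop)) (ii (by fun_prop)),
    intervalIntegral.integral_add (ii (by fun_prop)) (ii (by fun_prop)),
    intervalIntegral.integral_add (ii (by fun_prop)) (ii (by fun_prop)),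
    intervalIntegral.integral_add (ii (by fun_prop)) (ii (by fun_prop))] at hnn
  simp only [intervalIntegral.integral_const_mul, intervalIntegral.integral_const, smul_eq_mul,
    sub_zero, hI] at hnn ⊢
  refine hnn.trans_eq ?_
  field_simp
  ring

/-- In polar coordinates, the energy of a function on an annulus of radii `a` and `2a` bounds half its
variance on the inner circle. -/
theorem variance_le_integral_of_polar_energy_le {a C M : ℝ} (ha : 0 < a) {g gr gt : ℝ → ℝ → ℝ}
    {S : ℝ → ℝ} (hper : ∀ r, g r (2 * π) = g r 0)
    (hgr_cont : ∀ t, ContinuousOn (fun r => g r t) (Set.Icc a (2 * a)))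
    (hgt_cont : ∀ r ∈ Set.Icc a (2 * a), Continuous (g r))
    (hM : ∀ r ∈ Set.Icc a (2 * a), ∀ t, |g r t| ≤ M)
    (hgr : ∀ r ∈ Set.Ioo a (2 * a), ∀ t, HasDerivAt (fun x => g x t) (gr r t) r)
    (hgr' : ∀ r ∈ Set.Ioo a (2 * a), Continuous (gr r))
    (hC : ∀ r ∈ Set.Ioo a (2 * a), ∀ t, |gr r t| ≤ C)
    (hgt : ∀ r ∈ Set.Ioo a (2 * a), ∀ t, HasDerivAt (g r) (gt r t) t)
    (hgt' : ∀ r ∈ Set.Ioo a (2 * a), Continuous (gt r))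
    (hS : IntegrableOn S (Set.Icc a (2 * a)))
    (hle : ∀ r ∈ Set.Ioo a (2 * a), (∫ t in (0 : ℝ)..(2 * π), gt r t ^ 2) / r
      + r * (∫ t in (0 : ℝ)..(2 * π), gr r t ^ 2) ≤ S r) :
    (1 / 2) * ((∫ t in (0 : ℝ)..(2 * π), g a t ^ 2)
      - (∫ t in (0 : ℝ)..(2 * π), g a t) ^ 2 / (2 * π)) ≤ ∫ r in a..(2 * a), S r := by
  set V : ℝ → ℝ := fun r => (∫ t in (0 : ℝ)..(2 * π), g r t ^ 2)
    - (∫ t in (0 : ℝ)..(2 * π), g r t) ^ 2 / (2 * π)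
  set V' : ℝ → ℝ := fun r => (∫ t in (0 : ℝ)..(2 * π), 2 * g r t * gr r t)
    - (2 * (∫ t in (0 : ℝ)..(2 * π), g r t) * ∫ t in (0 : ℝ)..(2 * π), gr r t) / (2 * π)
  have hVcont : ContinuousOn V (Set.Icc a (2 * a)) := by
    have h1 : ContinuousOn (fun r => ∫ t in (0 : ℝ)..(2 * π), g r t ^ 2) (Set.Icc a (2 * a)) :=
      continuousOn_intervalIntegral_of_bounded (C := M ^ 2) (fun r hr => (hgt_cont r hr).pow 2)
        (fun r hr t => by
          rw [abs_pow]; exact pow_le_pow_left₀ (abs_nonneg _) (hM r hr t) 2)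
        (fun t => (hgr_cont t).pow 2)
    have h2 := continuousOn_intervalIntegral_of_bounded (a := 0) (b := 2 * π) hgt_cont hM hgr_cont
    exact h1.sub ((h2.pow 2).div_const _)
  have hVderiv : ∀ r ∈ Set.Ioo a (2 * a), HasDerivAt V (V' r) r := by
    intro r hr
    have hs := isOpen_Ioo.mem_nhds hr
    have hcont (x) (hx : x ∈ Set.Ioo a (2 * a)) := hgt_cont x (Set.Ioo_subset_Icc_self hx)
    have hb (x) (hx : x ∈ Set.Ioo a (2 * a)) := hM x (Set.Ioo_subset_Icc_self hx)
    have h1 := hasDerivAt_intervalIntegral_of_bounded (a := 0) (b := 2 * π) hs hcont (hgr' r hr)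
      hC hgr
    have h2 : HasDerivAt (fun r => ∫ t in (0 : ℝ)..(2 * π), g r t ^ 2)
        (∫ t in (0 : ℝ)..(2 * π), 2 * g r t * gr r t) r :=
      hasDerivAt_intervalIntegral_of_bounded (G' := fun x t => 2 * g x t * gr x t)
        (C := 2 * M * C) hs (fun x hx => (hcont x hx).pow 2)
        ((continuous_const.mul (hcont r hr)).mul (hgr' r hr))
        (fun x hx t => by
          rw [abs_mul, abs_mul, abs_two]
          have := hb x hx t
          have := hC x hx t
          have := abs_nonneg (g x t)
          gcongr
          linarith)
        (fun x hx t => by simpa using (hgr x hx t).fun_pow 2)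
    simpa [V, V'] using h2.fun_sub ((h1.fun_pow 2).div_const (2 * π))
  have hφ (r : ℝ) : HasDerivAt (fun r => (r - 2 * a) / (2 * a)) (1 / (2 * a)) r :=
    ((hasDerivAt_id r).sub_const _).div_const _
  have key := intervalIntegral.sub_le_integral_of_hasDeriv_right_of_le
    (g := fun r => (r - 2 * a) / (2 * a) * V r)
    (g' := fun r => 1 / (2 * a) * V r + (r - 2 * a) / (2 * a) * V' r) (φ := S)
    (by linarith : a ≤ 2 * a)
    (ContinuousOn.mul (by fun_prop) hVcont)
    (fun r hr => ((hφ r).mul (hVderiv r hr)).hasDerivWithinAt) hS ?_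
  · refine le_trans (le_of_eq ?_) key
    simp only [V]
    field_simp
    ring
  · intro r hr
    have hr0 : 0 < r := ha.trans hr.1
    have hc := hgt_cont r (Set.Ioo_subset_Icc_self hr)
    have hW : V r ≤ ∫ t in (0 : ℝ)..(2 * π), gt r t ^ 2 :=
      integral_sq_sub_sq_integral_le_integral_deriv_sq (hgt r hr) (hgt' r hr) (hper r)
    have hVnn : 0 ≤ V r := by
      simpa [V] using integral_sq_add_mul_add_nonneg hc (continuous_const (y := (0 : ℝ))) 1
    have hq : 0 ≤ ((2 * a - r) / (2 * a) / r) ^ 2 * V r + ((2 * a - r) / (2 * a) / r) * V' r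
        + ∫ t in (0 : ℝ)..(2 * π), gr r t ^ 2 :=
      integral_sq_add_mul_add_nonneg hc (hgr' r hr) _
    refine le_trans ?_ (hle r hr)
    set L := ∫ t in (0 : ℝ)..(2 * π), gr r t ^ 2
    have hq' : (r - 2 * a) / (2 * a) * V' r ≤ ((2 * a - r) / (2 * a)) ^ 2 / r * V r + r * L := by
      have h3 := mul_nonneg hr0.le hq
      have : r * (((2 * a - r) / (2 * a) / r) ^ 2 * V r + ((2 * a - r) / (2 * a) / r) * V' r + L)
        = ((2 * a - r) / (2 * a)) ^ 2 / r * V r + r * L - (r - 2 * a) / (2 * a) * V' r := by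
        field_simp
        ring
      linarith
    have hcoef : 1 / (2 * a) + ((2 * a - r) / (2 * a)) ^ 2 / r ≤ 1 / r := by
      rw [← sub_nonneg]
      have : 1 / r - (1 / (2 * a) + ((2 * a - r) / (2 * a)) ^ 2 / r)
          = (2 * a - r) / (4 * a ^ 2) := by
        field_simp
        ring
      rw [this]
      exact div_nonneg (by linarith [hr.2]) (by positivity)
    have h4 := mul_le_mul_of_nonneg_right hcoef hVnn
    have h5 : 1 / r * V r ≤ (∫ t in (0 : ℝ)..(2 * π), gt r t ^ 2) / r := by
      rw [one_div_mul_eq_div]; gcongr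
    linarith

theorem integral_annulus_eq_integral_polar {F : ℂ → ℝ} (hF : Measurable F) {q : ℂ} {a b C : ℝ}
    (ha : 0 ≤ a) (hab : a ≤ b) (hC : ∀ x ∈ ball q b \ closedBall q a, |F x| ≤ C) :
    IntegrableOn (fun r : ℝ => r * ∫ t in (0 : ℝ)..(2 * π), F (q + (r : ℂ) * Complex.exp (t * I)))
      (Set.Icc a b) ∧
    ∫ r in a..b, r * ∫ t in (0 : ℝ)..(2 * π), F (q + (r : ℂ) * Complex.exp (t * I))
      = ∫ x in ball q b \ closedBall q a, F x := by
  set p : ℝ × ℝ → ℂ := fun z => q + (z.1 : ℂ) * Complex.exp (z.2 * I)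
  have hpm : Measurable p := by fun_prop
  have hdist (z : ℝ × ℝ) (hz : 0 < z.1) : dist (p z) q = z.1 := by
    simp [p, dist_eq_norm, Complex.norm_exp_ofReal_mul_I, abs_of_pos hz]
  have hmem (z : ℝ × ℝ) (hz : 0 < z.1) :
      p z ∈ ball q b \ closedBall q a ↔ z.1 ∈ Set.Ioo a b := by
    rw [Set.mem_sdiff, mem_ball, mem_closedBall, hdist z hz, not_le, Set.mem_Ioo, and_comm]
  have hint : IntegrableOn (fun z : ℝ × ℝ => z.1 * F (p z)) (Set.Ioo a b ×ˢ Set.Ioo (-π) π)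
      (volume.prod volume) := by
    refine Measure.integrableOn_of_bounded (M := b * C) ?_
      (measurable_fst.mul (hF.comp hpm)).aestronglyMeasurable ?_
    · rw [Measure.prod_prod]
      exact ENNReal.mul_ne_top measure_Ioo_lt_top.ne measure_Ioo_lt_top.ne
    · refine (ae_restrict_iff' (measurableSet_Ioo.prod measurableSet_Ioo)).2
        (Filter.Eventually.of_forall fun z hz => ?_)
      have hz0 : 0 < z.1 := ha.trans_lt hz.1.1
      rw [norm_mul, Real.norm_eq_abs, Real.norm_eq_abs, abs_of_pos hz0]
      exact mul_le_mul hz.1.2.le (hC _ ((hmem z hz0).2 hz.1)) (abs_nonneg _)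
        (hz0.le.trans hz.1.2.le)
  have hangle (r : ℝ) : ∫ t in Set.Ioo (-π) π, r * F (p (r, t))
      = r * ∫ t in (0 : ℝ)..(2 * π), F (q + (r : ℂ) * Complex.exp (t * I)) := by
    have hper : Function.Periodic (fun t : ℝ => F (q + (r : ℂ) * Complex.exp (t * I))) (2 * π) := by
      intro t
      simp only [Complex.ofReal_add, Complex.ofReal_mul, Complex.ofReal_ofNat, add_mul,
        Complex.exp_periodic _]
    have h := hper.intervalIntegral_add_eq (-π) 0
    rw [integral_const_mul, ← integral_Ioc_eq_integral_Ioo,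
      ← intervalIntegral.integral_of_le (by linarith [Real.pi_pos])]
    rw [show -π + 2 * π = π by ring, zero_add] at h
    rw [← h]
  constructor
  · rw [integrableOn_Icc_iff_integrableOn_Ioo]
    rw [IntegrableOn, ← Measure.prod_restrict] at hint
    have := hint.integral_prod_left
    simp only [hangle] at this
    exact this
  · have hA : MeasurableSet (ball q b \ closedBall q a) :=
      measurableSet_ball.diff measurableSet_closedBall
    rw [← integral_indicator hA, ← integral_add_left_eq_self _ q,
      ← Complex.integral_comp_polarCoord_symm, intervalIntegral.integral_of_le hab,
      integral_Ioc_eq_integral_Ioo]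
    simp only [← hangle]
    rw [← setIntegral_prod _ hint, ← Measure.volume_eq_prod, polarCoord_target]
    have hsub : Set.Ioo a b ×ˢ Set.Ioo (-π) π ⊆ Set.Ioi (0 : ℝ) ×ˢ Set.Ioo (-π) π :=
      Set.prod_mono (fun r hr => ha.trans_lt hr.1) subset_rfl
    rw [setIntegral_eq_of_subset_of_forall_sdiff_eq_zero
      (measurableSet_Ioi.prod measurableSet_Ioo) hsub (f := fun z : ℝ × ℝ => z.1 •
        (ball q b \ closedBall q a).indicator F (q + Complex.polarCoord.symm z))]
    · refine setIntegral_congr_fun (measurableSet_Ioo.prod measurableSet_Ioo) fun z hz => ?_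
      have hz0 : 0 < z.1 := ha.trans_lt hz.1.1
      have hpz : q + Complex.polarCoord.symm z = p z := by
        simp [p, Complex.polarCoord_symm_apply, Complex.exp_mul_I]
      simp only [hpz, smul_eq_mul]
      rw [Set.indicator_of_mem ((hmem z hz0).2 hz.1)]
    · intro z hz
      have hz0 : 0 < z.1 := hz.1.1
      have hpz : q + Complex.polarCoord.symm z = p z := by
        simp [p, Complex.polarCoord_symm_apply, Complex.exp_mul_I]
      rw [hpz, Set.indicator_of_notMem, smul_zero]
      rw [hmem z hz0]
      exact fun h => hz.2 ⟨h, hz.1.2⟩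

theorem sq_add_sq_le_norm_sq (L : ℂ →L[ℝ] ℝ) {w : ℂ} (hw : ‖w‖ = 1) :
    L (w * I) ^ 2 + L w ^ 2 ≤ ‖L‖ ^ 2 := by
  set x := L w
  set y := L (w * I)
  have h : L (x • w + y • (w * I)) = y ^ 2 + x ^ 2 := by
    simp only [map_add, map_smul, smul_eq_mul, x, y]; ring
  have hn : ‖x • w + y • (w * I)‖ ^ 2 = y ^ 2 + x ^ 2 := by
    have : x • w + y • (w * I) = w * (x + y * I) := by simp only [real_smul]; ring
    rw [this, norm_mul, hw, one_mul, ← Complex.normSq_eq_norm_sq, Complex.normSq_add_mul_I]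
    ring
  have hle := L.le_opNorm (x • w + y • (w * I))
  rw [h, ← hn, Real.norm_eq_abs, abs_of_nonneg (by positivity)] at hle
  rw [← hn]
  have h0 := norm_nonneg (x • w + y • (w * I))
  rcases h0.eq_or_lt with h1 | h1
  · rw [← h1]; simp
  · gcongr
    exact le_of_mul_le_mul_right (by linarith) h1

theorem integral_sub_mean_sq {f : ℝ → ℝ} (hf : Continuous f) :
    ∫ x in (0 : ℝ)..(2 * π), (f x - (1 / (2 * π)) * ∫ y in (0 : ℝ)..(2 * π), f y) ^ 2
      = (∫ x in (0 : ℝ)..(2 * π), f x ^ 2) - (∫ x in (0 : ℝ)..(2 * π), f x) ^ 2 / (2 * π) := by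
  set m := (1 / (2 * π)) * ∫ y in (0 : ℝ)..(2 * π), f y with hm
  have hI : ∫ x in (0 : ℝ)..(2 * π), f x = 2 * π * m := by rw [hm]; field_simp
  have hexp : ∫ x in (0 : ℝ)..(2 * π), (f x - m) ^ 2
      = ∫ x in (0 : ℝ)..(2 * π), (f x ^ 2 + (-2 * m) * f x + m ^ 2) := by
    congr 1; ext x; ring
  have ii {k : ℝ → ℝ} (hk : Continuous k) : IntervalIntegrable k volume 0 (2 * π) :=
    hk.intervalIntegrable _ _
  rw [hexp, intervalIntegral.integral_add (ii (by fun_prop)) (ii (by fun_prop)),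
    intervalIntegral.integral_add (ii (by fun_prop)) (ii (by fun_prop)),
    intervalIntegral.integral_const_mul, intervalIntegral.integral_const, hI, smul_eq_mul]
  field_simp
  ring

/-- Off-center Dirichlet-energy lower bound: for `q` in the unit disk with
`r₀ < (1/2) dist(q, ∂B(0,1))` and `u` of class `C¹` on `closure(B(0,1)) \ B(q,r₀)` with
boundary values of mean `m` on `∂B(q,r₀)`,
`∫_{B(0,1)\B(q,r₀)} |∇u|² ≥ (1/(4r₀)) ∫_{∂B(q,r₀)} |u − m|²`. -/
theorem dirichlet_energy_lower_bound_offcenter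
    (r₀ : ℝ) (h0 : 0 < r₀) (q : ℂ) (hq1 : ‖q‖ < 1)
    (hq : r₀ < (1 / 2) * infDist q (sphere (0 : ℂ) 1))
    (u : ℂ → ℝ)
    (hu : ContDiffOn ℝ 1 u (closedBall 0 1 \ ball q r₀))
    (m : ℝ)
    (hm : m = (1 / (2 * π)) *
      ∫ θ in (0 : ℝ)..(2 * π), u (q + (r₀ : ℂ) * Complex.exp (θ * Complex.I))) :
    (1 / (4 * r₀)) * (r₀ *
        ∫ θ in (0 : ℝ)..(2 * π),
          (u (q + (r₀ : ℂ) * Complex.exp (θ * Complex.I)) - m) ^ 2)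
      ≤ ∫ x in ball (0 : ℂ) 1 \ ball q r₀, ‖fderiv ℝ u x‖ ^ 2 := by
  have hR : 2 * r₀ < 1 - ‖q‖ := by
    have : infDist q (sphere (0 : ℂ) 1) ≤ 1 - ‖q‖ := by
      have (w : ℂ) (hw : ‖w‖ = 1) (hqw : q = ‖q‖ * w) :
          infDist q (sphere (0 : ℂ) 1) ≤ 1 - ‖q‖ := by
        refine (infDist_le_dist_of_mem (by simpa using hw)).trans_eq (b := dist q w) ?_
        have h1 : q - w = ((‖q‖ - 1 : ℝ) : ℂ) * w := by
          nth_rewrite 1 [hqw]; push_cast; ring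
        rw [dist_eq_norm, h1, norm_mul, hw, mul_one, Complex.norm_real, Real.norm_eq_abs,
          abs_of_neg (by linarith)]
        ring
      exact this (Complex.exp (q.arg * I)) (Complex.norm_exp_ofReal_mul_I _)
        (Complex.norm_mul_exp_arg_mul_I q).symm
    linarith
  set K : Set ℂ := closedBall 0 1 \ ball q r₀ 
  have hKc : IsCompact K := (isCompact_closedBall 0 1).diff isOpen_ball
  set U : Set ℂ := ball 0 1 \ closedBall q r₀
  have hUo : IsOpen U := isOpen_ball.sdiff isClosed_closedBall
  have hUK : U ⊆ K := Set.sdiff_subset_sdiff ball_subset_closedBall ball_subset_closedBall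
  have hUint : U ⊆ interior K := interior_maximal hUK hUo
  have hball : closedBall q (2 * r₀) ⊆ ball 0 1 := fun x hx => by
    rw [mem_ball_zero_iff]
    rw [mem_closedBall, dist_eq_norm] at hx
    have := norm_add_le (x - q) q
    rw [sub_add_cancel] at this
    linarith
  obtain ⟨C, hC⟩ := hu.exists_norm_fderiv_le hKc
  obtain ⟨M, hM⟩ := hKc.exists_bound_of_continuousOn hu.continuousOn
  have hdiff (x) (hx : x ∈ U) : HasFDerivAt u (fderiv ℝ u x) x :=
    (((hu.contDiffAt (Filter.mem_of_superset (hUo.mem_nhds hx) hUK)).differentiableAt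
      one_ne_zero)).hasFDerivAt
  have hfderiv : ContinuousOn (fderiv ℝ u) U :=
    (hu.mono hUK).continuousOn_fderiv_of_isOpen hUo le_rfl
  have hFm : Measurable fun x => ‖fderiv ℝ u x‖ ^ 2 := by fun_prop
  have hF (x) (hx : x ∈ interior K) : ‖fderiv ℝ u x‖ ^ 2 ≤ C ^ 2 :=
    pow_le_pow_left₀ (norm_nonneg _) (hC x hx) 2
  have hAU : ball q (2 * r₀) \ closedBall q r₀ ⊆ U :=
    Set.sdiff_subset_sdiff_left (ball_subset_closedBall.trans hball)
  obtain ⟨hSint, hSeq⟩ := integral_annulus_eq_integral_polar hFm (q := q) h0.le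
    (by linarith : r₀ ≤ 2 * r₀) (C := C ^ 2) fun x hx => by
      rw [abs_of_nonneg (by positivity)]; exact hF x (hUint (hAU hx))
  set p : ℝ → ℝ → ℂ := fun r t => q + (r : ℂ) * Complex.exp (t * I)
  have hdist (r t : ℝ) (hr : 0 < r) : dist (p r t) q = r := by
    simp [p, dist_eq_norm, Complex.norm_exp_ofReal_mul_I, abs_of_pos hr]
  have hpK (r) (hr : r ∈ Set.Icc r₀ (2 * r₀)) (t) : p r t ∈ K := by
    have := hdist r t (h0.trans_le hr.1)
    refine ⟨ball_subset_closedBall (hball ?_), ?_⟩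
    · rw [mem_closedBall, this]; exact hr.2
    · rw [mem_ball, this, not_lt]; exact hr.1
  have hpU (r) (hr : r ∈ Set.Ioo r₀ (2 * r₀)) (t) : p r t ∈ U := by
    have := hdist r t (h0.trans hr.1)
    refine ⟨hball ?_, ?_⟩
    · rw [mem_closedBall, this]; exact hr.2.le
    · rw [mem_closedBall, this, not_le]; exact hr.1
  have hpr (r t : ℝ) : HasDerivAt (fun x => p x t) (Complex.exp (t * I)) r := by
    simpa [p] using (Complex.ofRealCLM.hasDerivAt (x := r)).mul_const (Complex.exp (t * I))
  have hpt (r t : ℝ) : HasDerivAt (p r) (r * (Complex.exp (t * I) * I)) t := by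
    have h1 : HasDerivAt (fun x : ℝ => (x : ℂ) * I) I t := by
      simpa using (Complex.ofRealCLM.hasDerivAt (x := t)).mul_const I
    exact (h1.cexp.const_mul (r : ℂ)).const_add q
  have hpc (r) : Continuous (p r) := by fun_prop
  have hpc' (t) : Continuous fun r => p r t := by fun_prop
  have hfp (r) (hr : r ∈ Set.Ioo r₀ (2 * r₀)) : Continuous fun t => fderiv ℝ u (p r t) :=
    hfderiv.comp_continuous (hpc r) (hpU r hr)
  have key := variance_le_integral_of_polar_energy_le h0 (C := C) (M := M)
    (g := fun r t => u (p r t))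
    (gr := fun r t => fderiv ℝ u (p r t) (Complex.exp (t * I)))
    (gt := fun r t => fderiv ℝ u (p r t) (r * (Complex.exp (t * I) * I)))
    (fun r => by simp [p, Complex.exp_two_pi_mul_I])
    (fun t => hu.continuousOn.comp (hpc' t).continuousOn fun r hr => hpK r hr t)
    (fun r hr => hu.continuousOn.comp_continuous (hpc r) (hpK r hr))
    (fun r hr t => hM _ (hpK r hr t))
    (fun r hr t => (hdiff _ (hpU r hr t)).comp_hasDerivAt r (hpr r t))
    (fun r hr => (hfp r hr).clm_apply (by fun_prop))
    (fun r hr t => by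
      have h1 := (fderiv ℝ u (p r t)).le_opNorm (Complex.exp (t * I))
      rw [Complex.norm_exp_ofReal_mul_I, mul_one] at h1
      exact h1.trans (hC _ (hUint (hpU r hr t))))
    (fun r hr t => (hdiff _ (hpU r hr t)).comp_hasDerivAt t (hpt r t))
    (fun r hr => (hfp r hr).clm_apply (by fun_prop))
    hSint ?_
  · have hvar : ∫ t in (0 : ℝ)..(2 * π), (u (p r₀ t) - m) ^ 2
        = (∫ t in (0 : ℝ)..(2 * π), u (p r₀ t) ^ 2)
          - (∫ t in (0 : ℝ)..(2 * π), u (p r₀ t)) ^ 2 / (2 * π) := by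
      rw [hm]
      exact integral_sub_mean_sq
        (hu.continuousOn.comp_continuous (hpc r₀) (hpK r₀ ⟨le_rfl, by linarith⟩))
    have hnn : 0 ≤ ∫ t in (0 : ℝ)..(2 * π), (u (p r₀ t) - m) ^ 2 :=
      intervalIntegral.integral_nonneg (by positivity) fun _ _ => sq_nonneg _
    rw [← hvar, hSeq] at key
    have hset : ∫ x in ball q (2 * r₀) \ closedBall q r₀, ‖fderiv ℝ u x‖ ^ 2
        ≤ ∫ x in ball (0 : ℂ) 1 \ ball q r₀, ‖fderiv ℝ u x‖ ^ 2 := by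
      have hae : (ball (0 : ℂ) 1 \ ball q r₀ : Set ℂ) =ᵐ[volume] U :=
        Filter.EventuallyEq.rfl.diff (ae_eq_set.2
          ⟨by rw [Set.sdiff_eq_empty.2 ball_subset_closedBall, measure_empty],
            by rw [closedBall_sdiff_ball, Measure.addHaar_sphere]⟩)
      rw [setIntegral_congr_set hae]
      refine setIntegral_mono_set ?_ (Filter.Eventually.of_forall fun x => by positivity)
        hAU.eventuallyLE
      refine Measure.integrableOn_of_bounded (M := C ^ 2) ?_ hFm.aestronglyMeasurable ?_
      · exact ((measure_mono Set.sdiff_subset).trans_lt measure_ball_lt_top).ne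
      · refine (ae_restrict_iff' hUo.measurableSet).2 (Filter.Eventually.of_forall fun x hx => ?_)
        rw [Real.norm_eq_abs, abs_of_nonneg (by positivity)]
        exact hF x (hUint hx)
    refine le_trans ?_ (key.trans hset)
    rw [← mul_assoc]
    gcongr
    field_simp
    norm_num
  · intro r hr
    have hr0 : 0 < r := h0.trans hr.1
    have hcr : Continuous fun t : ℝ => fderiv ℝ u (p r t) (Complex.exp (t * I)) :=
      (hfp r hr).clm_apply (by fun_prop)
    have hct : Continuous fun t : ℝ => fderiv ℝ u (p r t) (r * (Complex.exp (t * I) * I)) :=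
      (hfp r hr).clm_apply (by fun_prop)
    have hcn := hfp r hr
    rw [← intervalIntegral.integral_div, ← intervalIntegral.integral_const_mul,
      ← intervalIntegral.integral_const_mul, ← intervalIntegral.integral_add
        (Continuous.intervalIntegrable (by fun_prop) _ _)
        (Continuous.intervalIntegrable (by fun_prop) _ _)]
    refine intervalIntegral.integral_mono_on (by positivity)
      (Continuous.intervalIntegrable (by fun_prop) _ _)
      (Continuous.intervalIntegrable (by fun_prop) _ _) fun t _ => ?_
    have h1 := sq_add_sq_le_norm_sq (fderiv ℝ u (p r t)) (Complex.norm_exp_ofReal_mul_I t)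
    rw [← real_smul (x := r), map_smul, smul_eq_mul, mul_pow]
    refine le_trans (le_of_eq ?_) (mul_le_mul_of_nonneg_left h1 hr0.le)
    field_simp
end
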